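/- Extend the ⋆-action to w_∞ = [[−1,0],[0,1]] by (h⋆w_∞)(X,Y) := h(X, −Y) on P_{2k−2}(K), with w_∞ acting on ℙ¹(ℚ) by r ↦ −r, and for a modular symbol μ define (μ|w_∞){r,s} := (μ{−r, −s})⋆w_∞. Let μ be a Γ₀(p)-invariant P_{2k−2}(K)-valued modular symbol for the ⋆-action, let Q = [a,b,c] ∈ 𝓕_p, and let γ₀ ∈ Γ₀(p) satisfy Q⋆γ₀ = Q. Set Q′ := [a,−b,c] and γ₀′ := w_∞ γ₀⁻¹ w_∞ (so γ₀′ ∈ Γ₀(p) and Q′⋆γ₀′ = Q′). Then for all ω, ω′ ∈ ℙ¹(ℚ), ⟨(μ|w_∞){ω, γ₀ω}, Q^{k−1}⟩ = −⟨μ{ω′, γ₀′ω′}, (Q′)^{k−1}⟩. (This is the key cancellation underlying the fact that only the odd part of the modular symbol contributes to the rigid Shintani lift.) -/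

import Mathlib

open Matrix MvPolynomial

/-- `SL(2,ℤ)` -/
abbrev SL2Z := Matrix.SpecialLinearGroup (Fin 2) ℤ

/-- The discriminant of the binary quadratic form `[a,b,c]`, encoded as `(a,b,c)`. -/
def discBQF (Q : ℤ × ℤ × ℤ) : ℤ := Q.2.1 ^ 2 - 4 * Q.1 * Q.2.2

/-- The right ⋆-action of `SL(2,ℤ)` on binary quadratic forms:
`(Q ⋆ γ)(x,y) = Q(δx - γ₀y, -βx + αy)` for `γ = [[α,β],[γ₀,δ]]`, written on coefficients. -/
def starBQF (Q : ℤ × ℤ × ℤ) (g : SL2Z) : ℤ × ℤ × ℤ :=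
  (Q.1 * (g.1 1 1) ^ 2 - Q.2.1 * (g.1 0 1) * (g.1 1 1) + Q.2.2 * (g.1 0 1) ^ 2,
   -2 * Q.1 * (g.1 1 0) * (g.1 1 1) + Q.2.1 * ((g.1 0 0) * (g.1 1 1) + (g.1 0 1) * (g.1 1 0))
     - 2 * Q.2.2 * (g.1 0 0) * (g.1 0 1),
   Q.1 * (g.1 1 0) ^ 2 - Q.2.1 * (g.1 0 0) * (g.1 1 0) + Q.2.2 * (g.1 0 0) ^ 2)

/-- Membership in the set `𝓕_p`: positive discriminant, `p ∤ a`, `p ∣ b`, `p ∣ c`. -/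
def memF (p : ℕ) (Q : ℤ × ℤ × ℤ) : Prop :=
  0 < discBQF Q ∧ ¬ (p : ℤ) ∣ Q.1 ∧ (p : ℤ) ∣ Q.2.1 ∧ (p : ℤ) ∣ Q.2.2

/-- A binary quadratic form `[a,b,c]` regarded as the homogeneous polynomial
`a·X² + b·X·Y + c·Y²` of degree 2 over `K`. -/
noncomputable def bqfPoly (K : Type*) [Field K] (Q : ℤ × ℤ × ℤ) : MvPolynomial (Fin 2) K :=
  C (Q.1 : K) * X 0 ^ 2 + C (Q.2.1 : K) * X 0 * X 1 + C (Q.2.2 : K) * X 1 ^ 2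

/-- Substitution of variables along an integer 2×2 matrix:
`h(X,Y) ↦ h(m₀₀X + m₀₁Y, m₁₀X + m₁₁Y)`. -/
noncomputable def substMat (K : Type*) [Field K] (m : Matrix (Fin 2) (Fin 2) ℤ)
    (h : MvPolynomial (Fin 2) K) : MvPolynomial (Fin 2) K :=
  aeval ![C ((m 0 0 : ℤ) : K) * X 0 + C ((m 0 1 : ℤ) : K) * X 1,
          C ((m 1 0 : ℤ) : K) * X 0 + C ((m 1 1 : ℤ) : K) * X 1] h

/-- The `|`-action: `(h|γ)(X,Y) = h(aX + bY, cX + dY)` for `γ = [[a,b],[c,d]]`. -/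
noncomputable def actBar (K : Type*) [Field K] (g : SL2Z) (h : MvPolynomial (Fin 2) K) :
    MvPolynomial (Fin 2) K :=
  substMat K g.1 h

/-- The `⋆`-action: `(h⋆γ)(X,Y) = h(dX - cY, -bX + aY)` for `γ = [[a,b],[c,d]]`. -/
noncomputable def actStar (K : Type*) [Field K] (g : SL2Z) (h : MvPolynomial (Fin 2) K) :
    MvPolynomial (Fin 2) K :=
  substMat K !![g.1 1 1, -(g.1 1 0); -(g.1 0 1), g.1 0 0] h

/-- The pairing `⟨·,·⟩` on homogeneous polynomials of degree `2k-2`, determined by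
`⟨XⁱY^{2k-2-i}, XʲY^{2k-2-j}⟩ = (-1)ⁱ·binom(2k-2,i)⁻¹·δ_{j,2k-2-i}`. -/
noncomputable def pairingP (K : Type*) [Field K] (k : ℕ) (h g : MvPolynomial (Fin 2) K) : K :=
  ∑ i ∈ Finset.range (2 * k - 1),
    (-1 : K) ^ i * (((2 * k - 2).choose i : K))⁻¹ *
      coeff (Finsupp.single 0 i + Finsupp.single 1 (2 * k - 2 - i)) h *
      coeff (Finsupp.single 0 (2 * k - 2 - i) + Finsupp.single 1 i) g

/-- The projective line `ℙ¹(ℚ)`, realized as the projectivization of `ℚ²`. -/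
abbrev P1Q := Projectivization ℚ (Fin 2 → ℚ)

/-- The linear automorphism of `ℚ²` attached to `g ∈ SL(2,ℤ)`. -/
noncomputable def sl2LinEquiv (g : SL2Z) : (Fin 2 → ℚ) ≃ₗ[ℚ] (Fin 2 → ℚ) :=
  LinearMap.GeneralLinearGroup.toLinearEquiv
    (Matrix.GeneralLinearGroup.toLin
      (Matrix.SpecialLinearGroup.toGL
        (Matrix.SpecialLinearGroup.map (Int.castRingHom ℚ) g)))

/-- The Möbius action of `SL(2,ℤ)` on `ℙ¹(ℚ)`. -/
noncomputable def smulP1 (g : SL2Z) (x : P1Q) : P1Q :=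
  Projectivization.map (sl2LinEquiv g).toLinearMap (sl2LinEquiv g).injective x

/-- The involution `r ↦ -r` of `ℙ¹(ℚ)` (induced by the matrix `w_∞ = [[-1,0],[0,1]]`). -/
noncomputable def negP1 (x : P1Q) : P1Q :=
  Projectivization.map
    (LinearEquiv.ofInvolutive
      ({ toFun := fun v => ![-v 0, v 1]
         map_add' := by intro u v; funext i; fin_cases i <;> simp [Matrix.cons_val_zero, Matrix.cons_val_one] <;> ring
         map_smul' := by intro c v; funext i; fin_cases i <;> simp [Matrix.cons_val_zero, Matrix.cons_val_one] <;> ring } :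
        (Fin 2 → ℚ) →ₗ[ℚ] (Fin 2 → ℚ))
      (by intro v; funext i; fin_cases i <;> simp)).toLinearMap
    (LinearEquiv.ofInvolutive _ _).injective x

/-- The action of `w_∞ = [[-1,0],[0,1]]` on polynomials for the `|`-convention:
`(h|w_∞)(X,Y) = h(-X, Y)`. -/
noncomputable def actBarW (K : Type*) [Field K] (h : MvPolynomial (Fin 2) K) :
    MvPolynomial (Fin 2) K :=
  substMat K !![-1, 0; 0, 1] h

/-- The action of `w_∞` on polynomials for the `⋆`-convention: `(h⋆w_∞)(X,Y) = h(X, -Y)`. -/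
noncomputable def actStarW (K : Type*) [Field K] (h : MvPolynomial (Fin 2) K) :
    MvPolynomial (Fin 2) K :=
  substMat K !![1, 0; 0, -1] h

/-- The matrix `S = [[0,1],[-1,0]]` as an element of `SL(2,ℤ)`. -/
def matS : SL2Z := ⟨!![0, 1; -1, 0], by norm_num [Matrix.det_fin_two_of]⟩

/-- The conjugate `γ' = w_∞ γ w_∞` of `γ = [[α,β],[γ₀,δ]] ∈ SL(2,ℤ)`,
given by `[[α,-β],[-γ₀,δ]]`. -/
def conjW (g : SL2Z) : SL2Z :=
  ⟨!![g.1 0 0, -(g.1 0 1); -(g.1 1 0), g.1 1 1], by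
    have h2 : g.1.det = 1 := g.2
    rw [Matrix.det_fin_two] at h2
    rw [Matrix.det_fin_two_of]
    linarith⟩

/-! ### Helper lemmas -/

lemma aux_expand {K : Type*} [Field K] (n : ℕ) (h : MvPolynomial (Fin 2) K)
    (hh : h.IsHomogeneous n) :
    h = ∑ i ∈ Finset.range (n + 1),
      C (coeff (Finsupp.single 0 i + Finsupp.single 1 (n - i)) h) * (X 0 ^ i * X 1 ^ (n - i)) := by
  have key : ∀ i : ℕ, ∀ r : K, C r * ((X 0 : MvPolynomial (Fin 2) K) ^ i * X 1 ^ (n - i))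
      = monomial (Finsupp.single 0 i + Finsupp.single 1 (n - i)) r := by
    intro i r
    rw [X_pow_eq_monomial, X_pow_eq_monomial, monomial_mul, C_mul_monomial]
    simp
  simp only [key]
  ext d
  rw [coeff_sum]
  simp only [coeff_monomial]
  have hdeg : d.degree = d 0 + d 1 := by
    rw [Finsupp.degree_eq_sum]; simp [Fin.sum_univ_two]
  have hd : ∀ i, (Finsupp.single (0 : Fin 2) i + Finsupp.single 1 (n - i) = d) ↔
      (i = d 0 ∧ n - i = d 1) := by
    intro i
    constructor
    · rintro rfl; simp
    · rintro ⟨h0, h1⟩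
      ext j
      fin_cases j <;> simp [h0, h1]
      rw [← h0, h1]
  by_cases hn : d 0 + d 1 = n
  · rw [Finset.sum_eq_single (d 0)]
    · have : Finsupp.single (0 : Fin 2) (d 0) + Finsupp.single 1 (n - d 0) = d :=
        (hd _).2 ⟨rfl, by omega⟩
      rw [this, if_pos rfl]
    · intro i _ hi
      rw [if_neg]
      rw [hd]; tauto
    · intro hi
      exfalso; apply hi; simp; omega
  · rw [hh.coeff_eq_zero (by rw [hdeg]; exact hn)]
    symm
    apply Finset.sum_eq_zero
    intro i hi
    rw [if_neg]
    rw [hd]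
    simp at hi
    omega

lemma aux_pair_linear_form {K : Type*} [Field K] [CharZero K] (k : ℕ) (hk : 1 ≤ k)
    (h : MvPolynomial (Fin 2) K) (hh : h.IsHomogeneous (2 * k - 2)) (u v : K) :
    pairingP K k h ((C u * X 0 + C v * X 1) ^ (2 * k - 2)) = eval ![-v, u] h := by
  conv_rhs => rw [aux_expand _ h hh]
  unfold pairingP
  rw [show 2 * k - 1 = 2 * k - 2 + 1 by omega]
  generalize 2 * k - 2 = n at *
  rw [map_sum]
  apply Finset.sum_congr rfl
  intro i hi
  have hin : i ≤ n := by simp at hi; omega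
  have hc : coeff (Finsupp.single 0 (n - i) + Finsupp.single 1 i)
      ((C u * X 0 + C v * X 1 : MvPolynomial (Fin 2) K) ^ n) = u ^ (n - i) * v ^ i * n.choose i := by
    have hterm : ∀ m, ((C u * X 0 : MvPolynomial (Fin 2) K) ^ m * (C v * X 1) ^ (n - m) *
          ((n.choose m : ℕ) : MvPolynomial (Fin 2) K))
        = monomial (Finsupp.single 0 m + Finsupp.single 1 (n - m))
            (u ^ m * v ^ (n - m) * n.choose m) := by
      intro m
      rw [mul_pow, mul_pow, X_pow_eq_monomial, X_pow_eq_monomial, ← C_pow, ← C_pow,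
        C_mul_monomial, C_mul_monomial, monomial_mul, ← map_natCast (C : K →+* MvPolynomial (Fin 2) K),
        mul_comm, C_mul_monomial]
      congr 1
      ring
    rw [add_pow, Finset.sum_congr rfl (fun m _ => hterm m), coeff_sum]
    simp only [coeff_monomial]
    rw [Finset.sum_eq_single (n - i)]
    · rw [Nat.sub_sub_self hin, if_pos rfl, Nat.choose_symm hin]
    · intro m _ hm
      rw [if_neg]
      intro he
      apply hm
      have := DFunLike.congr_fun he (0 : Fin 2)
      simpa using this
    · intro hx
      exfalso; apply hx; simp
  rw [hc]
  have hne : ((n.choose i : ℕ) : K) ≠ 0 := by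
    exact_mod_cast (Nat.choose_pos hin).ne'
  simp only [map_mul, map_pow, eval_C, eval_X, Matrix.cons_val_zero, Matrix.cons_val_one]
  rw [neg_pow v i]
  field_simp

lemma aux_pair_add_left {K : Type*} [Field K] (k : ℕ) (h h' f : MvPolynomial (Fin 2) K) :
    pairingP K k (h + h') f = pairingP K k h f + pairingP K k h' f := by
  simp only [pairingP, coeff_add, ← Finset.sum_add_distrib]
  exact Finset.sum_congr rfl fun i _ => by ring

/-- The pairing as a linear functional of its second argument. -/
noncomputable def pairLin (K : Type*) [Field K] (k : ℕ) (h : MvPolynomial (Fin 2) K) :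
    MvPolynomial (Fin 2) K →ₗ[K] K where
  toFun f := pairingP K k h f
  map_add' f g := by
    simp only [pairingP, coeff_add, ← Finset.sum_add_distrib]
    exact Finset.sum_congr rfl fun i _ => by ring
  map_smul' r f := by
    simp only [pairingP, coeff_smul, smul_eq_mul, RingHom.id_apply, Finset.mul_sum]
    exact Finset.sum_congr rfl fun i _ => by ring

/-- Substitution as an algebra homomorphism. -/
noncomputable def substHom (K : Type*) [Field K] (m : Matrix (Fin 2) (Fin 2) ℤ) :
    MvPolynomial (Fin 2) K →ₐ[K] MvPolynomial (Fin 2) K :=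
  aeval ![C ((m 0 0 : ℤ) : K) * X 0 + C ((m 0 1 : ℤ) : K) * X 1,
          C ((m 1 0 : ℤ) : K) * X 0 + C ((m 1 1 : ℤ) : K) * X 1]

lemma substHom_apply (K : Type*) [Field K] (m : Matrix (Fin 2) (Fin 2) ℤ)
    (h : MvPolynomial (Fin 2) K) : substHom K m h = substMat K m h := rfl

/-- A linear functional killing all `(X + tY)^n` kills homogeneous polynomials of degree `n`. -/
lemma aux_span {K : Type*} [Field K] [CharZero K] (n : ℕ) (L : MvPolynomial (Fin 2) K →ₗ[K] K)
    (hL : ∀ t : K, L ((C 1 * X 0 + C t * X 1) ^ n) = 0)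
    (f : MvPolynomial (Fin 2) K) (hf : f.IsHomogeneous n) : L f = 0 := by
  have hC : ∀ (r : K) (g : MvPolynomial (Fin 2) K), L (C r * g) = r * L g := by
    intro r g; rw [← smul_eq_C_mul, map_smul, smul_eq_mul]
  have hpoly : (∑ i ∈ Finset.range (n + 1),
      Polynomial.monomial (n - i) ((n.choose i : K) * L (X 0 ^ i * X 1 ^ (n - i)))) = 0 := by
    apply Polynomial.funext
    intro t
    rw [Polynomial.eval_finsetSum, Polynomial.eval_zero, ← hL t, add_pow, map_sum]
    apply Finset.sum_congr rfl
    intro i _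
    rw [Polynomial.eval_monomial, show ((C 1 * X 0 : MvPolynomial (Fin 2) K) ^ i *
      (C t * X 1) ^ (n - i) * ((n.choose i : ℕ) : MvPolynomial (Fin 2) K)) = C (t ^ (n - i) * n.choose i) * (X 0 ^ i * X 1 ^ (n - i)) by
        simp only [map_mul, map_pow, map_natCast, map_one]; ring, hC]
    ring
  have hmon : ∀ i ∈ Finset.range (n + 1), L (X 0 ^ i * X 1 ^ (n - i)) = 0 := by
    intro i hi
    have hin : i ≤ n := by simp at hi; omega
    have := congrArg (fun q => Polynomial.coeff q (n - i)) hpoly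
    simp only [Polynomial.finsetSum_coeff, Polynomial.coeff_monomial, Polynomial.coeff_zero] at this
    rw [Finset.sum_eq_single i] at this
    · rw [if_pos rfl] at this
      have hne : ((n.choose i : ℕ) : K) ≠ 0 := by
        exact_mod_cast (Nat.choose_pos hin).ne'
      exact (mul_eq_zero.1 this).resolve_left hne
    · intro j hj hji
      rw [if_neg]
      simp at hj
      omega
    · intro hx; exact absurd hi hx
  rw [aux_expand n f hf, map_sum]
  apply Finset.sum_eq_zero
  intro i hi
  rw [hC, hmon i hi, mul_zero]

lemma aux_subst_homog {K : Type*} [Field K] (n : ℕ) (m : Matrix (Fin 2) (Fin 2) ℤ)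
    (h : MvPolynomial (Fin 2) K) (hh : h.IsHomogeneous n) : (substMat K m h).IsHomogeneous n := by
  have hlin : ∀ r s : K, (C r * X 0 + C s * X 1 : MvPolynomial (Fin 2) K).IsHomogeneous 1 :=
    fun r s => (isHomogeneous_C_mul_X r 0).add (isHomogeneous_C_mul_X s 1)
  have := hh.aeval (τ := Fin 2) ![C ((m 0 0 : ℤ) : K) * X 0 + C ((m 0 1 : ℤ) : K) * X 1,
          C ((m 1 0 : ℤ) : K) * X 0 + C ((m 1 1 : ℤ) : K) * X 1] (n := 1)
          (by intro i; fin_cases i; exacts [hlin _ _, hlin _ _])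
  rwa [one_mul] at this

lemma aux_eval_subst {K : Type*} [Field K] (m : Matrix (Fin 2) (Fin 2) ℤ)
    (h : MvPolynomial (Fin 2) K) (x y : K) :
    eval ![x, y] (substMat K m h) =
      eval ![(m 0 0 : K) * x + (m 0 1 : K) * y, (m 1 0 : K) * x + (m 1 1 : K) * y] h := by
  unfold substMat
  induction h using MvPolynomial.induction_on with
  | C r => simp
  | add f g hf hg => simp only [map_add, hf, hg]
  | mul_X f i hf =>
    rw [map_mul, map_mul, map_mul, hf]
    congr 1
    fin_cases i <;> simp

lemma aux_pair_inv {K : Type*} [Field K] [CharZero K] (k : ℕ) (hk : 1 ≤ k)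
    (m : Matrix (Fin 2) (Fin 2) ℤ) (hm : m 0 0 * m 1 1 - m 0 1 * m 1 0 = 1)
    (h f : MvPolynomial (Fin 2) K) (hh : h.IsHomogeneous (2 * k - 2))
    (hf : f.IsHomogeneous (2 * k - 2)) :
    pairingP K k (substMat K m h) (substMat K m f) = pairingP K k h f := by
  have hmK : (m 0 0 : K) * m 1 1 - m 0 1 * m 1 0 = 1 := by exact_mod_cast congrArg (Int.cast : ℤ → K) hm
  have := aux_span (2 * k - 2)
    ((pairLin K k (substMat K m h)).comp (substHom K m).toLinearMap - pairLin K k h) ?_ f hf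
  · exact sub_eq_zero.1 this
  · intro t
    have e : substHom K m ((C 1 * X 0 + C t * X 1) ^ (2 * k - 2)) =
        (C ((m 0 0 : K) + t * m 1 0) * X 0 + C ((m 0 1 : K) + t * m 1 1) * X 1) ^ (2 * k - 2) := by
      rw [map_pow]
      congr 1
      simp only [substHom, map_add, map_mul, aeval_X, algHom_C, algebraMap_eq, map_one,
        Matrix.cons_val_zero, Matrix.cons_val_one]
      ring
    change pairingP K k (substMat K m h) (substHom K m _) - pairingP K k h _ = 0
    rw [e, aux_pair_linear_form k hk _ (aux_subst_homog _ m h hh), aux_pair_linear_form k hk _ hh,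
      aux_eval_subst, sub_eq_zero]
    congr 3
    · linear_combination -t * hmK
    · congr 1
      linear_combination hmK

lemma aux_pair_W {K : Type*} [Field K] [CharZero K] (k : ℕ) (hk : 1 ≤ k)
    (h f : MvPolynomial (Fin 2) K) (hh : h.IsHomogeneous (2 * k - 2))
    (hf : f.IsHomogeneous (2 * k - 2)) :
    pairingP K k (actStarW K h) f = pairingP K k h (actStarW K f) := by
  have := aux_span (2 * k - 2)
    ((pairLin K k h).comp (substHom K !![1, 0; 0, -1]).toLinearMap
      - pairLin K k (substMat K !![1, 0; 0, -1] h)) ?_ f hf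
  · exact (sub_eq_zero.1 this).symm
  · intro t
    have e : substHom K !![1, 0; 0, -1] ((C 1 * X 0 + C t * X 1) ^ (2 * k - 2)) =
        (C (1 : K) * X 0 + C (-t) * X 1) ^ (2 * k - 2) := by
      rw [map_pow]
      congr 1
      simp [substHom]
    change pairingP K k h (substHom K _ _) - pairingP K k _ _ = 0
    rw [e, aux_pair_linear_form k hk _ (aux_subst_homog _ _ h hh), aux_pair_linear_form k hk _ hh,
      aux_eval_subst, sub_eq_zero]
    have hev : ∀ x y : K, eval ![-x, -y] h = eval ![x, y] h := by
      intro x y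
      rw [aux_expand _ h hh, map_sum, map_sum]
      apply Finset.sum_congr rfl
      intro i hi
      simp only [map_mul, map_pow, eval_C, eval_X, Matrix.cons_val_zero, Matrix.cons_val_one]
      congr 1
      have hin : i ≤ 2 * k - 2 := by simp at hi; omega
      rw [neg_pow x, neg_pow y, mul_mul_mul_comm, ← pow_add, Nat.add_sub_cancel' hin,
        show 2 * k - 2 = 2 * (k - 1) by omega, pow_mul]
      simp
    rw [← hev]
    simp

lemma aux_bqf_homog {K : Type*} [Field K] (k : ℕ) (Q : ℤ × ℤ × ℤ) :
    (bqfPoly K Q ^ (k - 1)).IsHomogeneous (2 * k - 2) := by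
  have h2 : (bqfPoly K Q).IsHomogeneous 2 := by
    unfold bqfPoly
    refine ((IsHomogeneous.add ?_ ?_).add ?_)
    · simpa using (isHomogeneous_C (Fin 2) (Q.1 : K)).mul ((isHomogeneous_X K (0 : Fin 2)).pow 2)
    · simpa using (isHomogeneous_C_mul_X (Q.2.1 : K) (0 : Fin 2)).mul (isHomogeneous_X K (1 : Fin 2))
    · simpa using (isHomogeneous_C (Fin 2) (Q.2.2 : K)).mul ((isHomogeneous_X K (1 : Fin 2)).pow 2)
  have := h2.pow (k - 1)
  rwa [show 2 * (k - 1) = 2 * k - 2 by omega] at this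

lemma aux_bqf_W {K : Type*} [Field K] (a b c : ℤ) (n : ℕ) :
    actStarW K (bqfPoly K (a, b, c) ^ n) = bqfPoly K (a, -b, c) ^ n := by
  unfold actStarW
  rw [← substHom_apply, map_pow]
  congr 1
  simp [substHom, bqfPoly, algHom_C]

lemma aux_bqf_star {K : Type*} [Field K] (Q : ℤ × ℤ × ℤ) (g : SL2Z) (n : ℕ) :
    actStar K g (bqfPoly K Q ^ n) = bqfPoly K (starBQF Q g) ^ n := by
  unfold actStar
  rw [← substHom_apply, map_pow]
  congr 1
  have h2 : (C (2 : K) : MvPolynomial (Fin 2) K) = 2 := map_ofNat C 2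
  simp [substHom, bqfPoly, starBQF, h2]
  ring

lemma aux_sl2_apply (g : SL2Z) (v : Fin 2 → ℚ) :
    sl2LinEquiv g v = ![(g.1 0 0 : ℚ) * v 0 + g.1 0 1 * v 1, (g.1 1 0 : ℚ) * v 0 + g.1 1 1 * v 1] := by
  have : sl2LinEquiv g v = (g.1.map (Int.cast : ℤ → ℚ)) *ᵥ v := rfl
  rw [this]
  funext i
  fin_cases i <;> simp [Matrix.mulVec, dotProduct, Fin.sum_univ_two]

lemma aux_neg_smul (g : SL2Z) (x : P1Q) : negP1 (smulP1 g x) = smulP1 (conjW g) (negP1 x) := by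
  induction x using Projectivization.ind with
  | h v hv =>
    simp only [smulP1, negP1, Projectivization.map_mk]
    congr 1
    change ![-(sl2LinEquiv g v) 0, (sl2LinEquiv g v) 1] = sl2LinEquiv (conjW g) ![-v 0, v 1]
    rw [aux_sl2_apply, aux_sl2_apply]
    funext i
    fin_cases i <;> simp [conjW] <;> ring

lemma aux_smul_inv (g : SL2Z) (x : P1Q) : smulP1 (conjW g) (smulP1 (conjW g⁻¹) x) = x := by
  have hd : (g.1 0 0 : ℚ) * g.1 1 1 - g.1 0 1 * g.1 1 0 = 1 := by
    have h2 : g.1.det = 1 := g.2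
    rw [Matrix.det_fin_two] at h2
    exact_mod_cast h2
  induction x using Projectivization.ind with
  | h v hv =>
    simp only [smulP1, Projectivization.map_mk]
    congr 1
    change sl2LinEquiv (conjW g) (sl2LinEquiv (conjW g⁻¹) v) = v
    rw [aux_sl2_apply, aux_sl2_apply, Matrix.SpecialLinearGroup.SL2_inv_expl]
    funext i
    fin_cases i
    · simp [conjW]
      linear_combination v 0 * hd
    · simp [conjW]
      linear_combination v 1 * hd

/-- the key cancellation: for a `Γ₀(p)`-invariant `P_{2k-2}(K)`-valued modular
symbol `μ` (⋆-action), `Q = [a,b,c] ∈ 𝓕_p`, and `γ₀ ∈ Γ₀(p)` with `Q⋆γ₀ = Q`, setting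
`Q′ := [a,−b,c]` and `γ₀′ := w_∞ γ₀⁻¹ w_∞`, one has `γ₀′ ∈ Γ₀(p)`, `Q′⋆γ₀′ = Q′`, and
`⟨(μ|w_∞){ω, γ₀ω}, Q^{k−1}⟩ = −⟨μ{ω′, γ₀′ω′}, (Q′)^{k−1}⟩` for all `ω, ω′ ∈ ℙ¹(ℚ)`,
where `(μ|w_∞){r,s} := (μ{−r, −s})⋆w_∞`. -/
theorem odd_part_cancellation (p k : ℕ) (hp : p.Prime) (hk : 1 ≤ k)
    (K : Type*) [Field K] [CharZero K]
    (μ : P1Q → P1Q → MvPolynomial (Fin 2) K)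
    (hsym : ∀ r s t : P1Q, μ r s + μ s t = μ r t)
    (hval : ∀ r s : P1Q, (μ r s).IsHomogeneous (2 * k - 2))
    (hinv : ∀ γ : SL2Z, (p : ℤ) ∣ γ.1 1 0 →
      ∀ r s : P1Q, actStar K γ (μ (smulP1 γ r) (smulP1 γ s)) = μ r s)
    (a b c : ℤ) (hQ : memF p (a, b, c))
    (γ₀ : SL2Z) (hγ₀ : (p : ℤ) ∣ γ₀.1 1 0) (hfix : starBQF (a, b, c) γ₀ = (a, b, c)) :
    (p : ℤ) ∣ (conjW γ₀⁻¹).1 1 0 ∧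
    starBQF (a, -b, c) (conjW γ₀⁻¹) = (a, -b, c) ∧
    ∀ ω ω' : P1Q,
      pairingP K k (actStarW K (μ (negP1 ω) (negP1 (smulP1 γ₀ ω))))
          (bqfPoly K (a, b, c) ^ (k - 1)) =
        - pairingP K k (μ ω' (smulP1 (conjW γ₀⁻¹) ω'))
            (bqfPoly K (a, -b, c) ^ (k - 1)) := by
  have hd : γ₀.1 0 0 * γ₀.1 1 1 - γ₀.1 0 1 * γ₀.1 1 0 = 1 := by
    have h2 : γ₀.1.det = 1 := γ₀.2
    rwa [Matrix.det_fin_two] at h2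
  have hfix' := hfix
  simp only [starBQF, Prod.mk.injEq] at hfix'
  obtain ⟨h1, h2, h3⟩ := hfix'
  refine ⟨?_, ?_, ?_⟩
  · rw [Matrix.SpecialLinearGroup.SL2_inv_expl]
    simpa [conjW] using hγ₀
  · rw [Matrix.SpecialLinearGroup.SL2_inv_expl]
    simp only [starBQF, conjW, Prod.mk.injEq, Matrix.of_apply, Matrix.cons_val', Matrix.cons_val_zero,
      Matrix.cons_val_one, Matrix.cons_val_fin_one]
    generalize γ₀.1 0 0 = α at *
    generalize γ₀.1 0 1 = β at *
    generalize γ₀.1 1 0 = γ at *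
    generalize γ₀.1 1 1 = δ at *
    refine ⟨?_, ?_, ?_⟩
    · linear_combination -α ^ 2 * h1 - α * β * h2 - β ^ 2 * h3 + a * (α * δ - β * γ + 1) * hd
    · linear_combination 2 * α * γ * h1 + (α * δ + β * γ) * h2 + 2 * β * δ * h3
        - b * (α * δ - β * γ + 1) * hd
    · linear_combination -γ ^ 2 * h1 - γ * δ * h2 - δ ^ 2 * h3 + c * (α * δ - β * γ + 1) * hd
  · intro ω ω'
    have hfg : starBQF (a, -b, c) (conjW γ₀) = (a, -b, c) := by
      simp only [starBQF, conjW, Prod.mk.injEq, Matrix.of_apply, Matrix.cons_val',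
        Matrix.cons_val_zero, Matrix.cons_val_one, Matrix.cons_val_fin_one]
      refine ⟨?_, ?_, ?_⟩
      · linear_combination h1
      · linear_combination -h2
      · linear_combination h3
    have hg : (p : ℤ) ∣ (conjW γ₀).1 1 0 := by simpa [conjW] using hγ₀
    rw [aux_pair_W k hk _ _ (hval _ _) (aux_bqf_homog k _), aux_bqf_W, aux_neg_smul]
    -- invariance of the pairing of `μ` with `Q'^(k-1)` under `γ₀'⁻¹`
    have hI : ∀ r s : P1Q,
        pairingP K k (μ (smulP1 (conjW γ₀) r) (smulP1 (conjW γ₀) s))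
          (bqfPoly K (a, -b, c) ^ (k - 1)) =
        pairingP K k (μ r s) (bqfPoly K (a, -b, c) ^ (k - 1)) := by
      intro r s
      have e := aux_pair_inv (K := K) k hk
        !![(conjW γ₀).1 1 1, -((conjW γ₀).1 1 0); -((conjW γ₀).1 0 1), (conjW γ₀).1 0 0]
        (by simp [conjW]; linear_combination hd)
        (μ (smulP1 (conjW γ₀) r) (smulP1 (conjW γ₀) s)) (bqfPoly K (a, -b, c) ^ (k - 1))
        (hval _ _) (aux_bqf_homog k _)
      rw [← e]
      change pairingP K k (actStar K (conjW γ₀) _) (actStar K (conjW γ₀) _) = _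
      rw [hinv _ hg, aux_bqf_star, hfg]
    have hadd : ∀ r s t : P1Q,
        pairingP K k (μ r s) (bqfPoly K (a, -b, c) ^ (k - 1)) +
          pairingP K k (μ s t) (bqfPoly K (a, -b, c) ^ (k - 1)) =
        pairingP K k (μ r t) (bqfPoly K (a, -b, c) ^ (k - 1)) := by
      intro r s t
      rw [← aux_pair_add_left, hsym]
    have e1 := hI ω' (smulP1 (conjW γ₀⁻¹) ω')
    rw [aux_smul_inv] at e1
    have e2 := hI (negP1 ω) ω'
    have e3 := hadd (negP1 ω) (smulP1 (conjW γ₀) (negP1 ω)) (smulP1 (conjW γ₀) ω')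
    have e4 := hadd (negP1 ω) (smulP1 (conjW γ₀) ω') ω'
    linear_combination e3 + e4 - e1 - e2
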